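/- arXiv:1701.04309 — 2 statements merged into one kernel-verified Lean document; each statement's English description precedes it below -/
import Mathlib

section
/- For every p ∈ 𝕄²ˣ²_sym with |p_D| > (tr p)/(2α), the set {σ : p | σ ∈ K} is not bounded above; that is, the support function of K at p is +∞. -/
open Matrix Set
open scoped Classical

attribute [local instance] Matrix.frobeniusNormedAddCommGroup Matrix.frobeniusNormedSpace

noncomputable section

/-- The space of real 2×2 matrices (symmetric ones are singled out by `Matrix.IsSymm`). -/
abbrev M2 : Type := Matrix (Fin 2) (Fin 2) ℝ

/-- Frobenius inner product `A : B = tr (Aᵀ B)`. -/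
def inn (A B : M2) : ℝ := (Aᵀ * B).trace

/-- Frobenius norm `|A| = √(A : A)`. -/
def fnorm (A : M2) : ℝ := Real.sqrt (inn A A)

/-- Deviatoric part `A_D = A − (tr A / 2) Id`. -/
def dev (A : M2) : M2 := A - (A.trace / 2) • (1 : M2)

/-- The set of symmetric matrices `𝕄²ˣ²_sym`. -/
def Msym : Set M2 := {A | A.IsSymm}

/-- The Drucker–Prager elasticity set `K = {σ ∈ 𝕄²ˣ²_sym : |σ_D| + α tr σ ≤ κ}`. -/
def Kset (α κ : ℝ) : Set M2 :=
  {σ | σ.IsSymm ∧ fnorm (dev σ) + α * σ.trace ≤ κ}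

/-- The isotropic elasticity tensor `ℂ e = λ (tr e) Id + 2 μ e`. -/
def Cc (lam mu : ℝ) (e : M2) : M2 := (lam * e.trace) • (1 : M2) + (2 * mu) • e

/-- The inverse elasticity tensor `ℂ⁻¹ σ = (tr σ / (4 K₀)) Id + (1/(2μ)) σ_D`, `K₀ = λ + μ`. -/
def Cinv (lam mu : ℝ) (σ : M2) : M2 :=
  (σ.trace / (4 * (lam + mu))) • (1 : M2) + (1 / (2 * mu)) • dev σ

/-- The constant `β = (1/μ + 1/(2 α² K₀))⁻¹`. -/
def betaC (α lam mu : ℝ) : ℝ := (1 / mu + 1 / (2 * α ^ 2 * (lam + mu)))⁻¹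

/-- The function `g`. -/
def gfun (α κ lam mu : ℝ) (ξ : M2) : ℝ :=
  if 2 * mu * fnorm (dev ξ) + 2 * α * (lam + mu) * ξ.trace ≤ κ then
    ((lam + mu) / 2) * ξ.trace ^ 2 + mu * fnorm (dev ξ) ^ 2
  else
    κ * ξ.trace / (2 * α) - κ ^ 2 / (8 * α ^ 2 * (lam + mu)) +
      betaC α lam mu *
        max (fnorm (dev ξ) - ξ.trace / (2 * α) + κ / (4 * α ^ 2 * (lam + mu))) 0 ^ 2

/-- The (matrix representing the) differential of `g`. -/
def Dg (α κ lam mu : ℝ) (ξ : M2) : M2 :=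
  if 2 * mu * fnorm (dev ξ) + 2 * α * (lam + mu) * ξ.trace ≤ κ then
    ((lam + mu) * ξ.trace) • (1 : M2) + (2 * mu) • dev ξ
  else
    (κ / (2 * α)) • (1 : M2) +
      (2 * betaC α lam mu *
          max (fnorm (dev ξ) - ξ.trace / (2 * α) + κ / (4 * α ^ 2 * (lam + mu))) 0) •
        ((fnorm (dev ξ))⁻¹ • dev ξ - (1 / (2 * α)) • (1 : M2))

/-- The open cone `𝒜₁ = {ξ ∈ 𝕄²ˣ²_sym : μ |ξ_D| + α K₀ tr ξ < 0}`. -/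
def A1 (α lam mu : ℝ) : Set M2 :=
  {ξ | ξ.IsSymm ∧ mu * fnorm (dev ξ) + α * (lam + mu) * ξ.trace < 0}

/-- The open cone `𝒜₂ = {ξ ∈ 𝕄²ˣ²_sym : |ξ_D| < tr ξ / (2α)}`. -/
def A2 (α : ℝ) : Set M2 :=
  {ξ | ξ.IsSymm ∧ fnorm (dev ξ) < ξ.trace / (2 * α)}

/-- The cone `𝒜₃ = 𝕄²ˣ²_sym ∖ (cl 𝒜₁ ∪ cl 𝒜₂)`. -/
def A3 (α lam mu : ℝ) : Set M2 :=
  Msym \ (closure (A1 α lam mu) ∪ closure (A2 α))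

/-- The function `G(ξ) = Dg(ξ + (κ/(4αK₀)) Id)`, given by its explicit piecewise expression. -/
def Gfun (α κ lam mu : ℝ) (ξ : M2) : M2 :=
  if ξ ∈ A1 α lam mu then
    (κ / (2 * α)) • (1 : M2) + ((lam + mu) * ξ.trace) • (1 : M2) + (2 * mu) • dev ξ
  else if ξ ∈ A2 α ∨ ξ = 0 then
    (κ / (2 * α)) • (1 : M2)
  else
    (κ / (2 * α)) • (1 : M2) +
      (2 * betaC α lam mu * (fnorm (dev ξ) - ξ.trace / (2 * α))) •
        ((fnorm (dev ξ))⁻¹ • dev ξ - (1 / (2 * α)) • (1 : M2))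

/-- The map `𝒢(ξ, η)`. -/
def calG (α lam mu : ℝ) (ξ η : M2) : M2 :=
  if ξ ∈ A1 α lam mu then
    ((lam + mu) * η.trace) • (1 : M2) + (2 * mu) • dev η
  else if ξ ∈ A2 α ∨ ξ = 0 then
    0
  else
    (2 * betaC α lam mu * (inn (dev ξ) (dev η) / fnorm (dev ξ) - η.trace / (2 * α))) •
      ((fnorm (dev ξ))⁻¹ • dev ξ - (1 / (2 * α)) • (1 : M2)) +
    (2 * betaC α lam mu * (fnorm (dev ξ) - ξ.trace / (2 * α)) * (fnorm (dev ξ))⁻¹) •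
      (dev η - (inn (dev ξ) (dev η) / fnorm (dev ξ) ^ 2) • dev ξ)

/-- The relative boundary `∂𝒜₁` of `𝒜₁` inside `𝕄²ˣ²_sym`. -/
def bdryA1 (α lam mu : ℝ) : Set M2 := closure (A1 α lam mu) \ A1 α lam mu

/-- The relative boundary `∂𝒜₂` of `𝒜₂` inside `𝕄²ˣ²_sym`. -/
def bdryA2 (α : ℝ) : Set M2 := closure (A2 α) \ A2 α

/-- The outward normal `ν(σ) = μ σ_D/|σ_D| + α K₀ Id` for `σ ∈ ∂𝒜₁ ∖ {0}`. -/
def nu1 (α lam mu : ℝ) (σ : M2) : M2 :=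
  (mu * (fnorm (dev σ))⁻¹) • dev σ + (α * (lam + mu)) • (1 : M2)

/-- The outward normal `ν(σ) = σ_D/|σ_D| − (1/(2α)) Id` for `σ ∈ ∂𝒜₂ ∖ {0}`. -/
def nu2 (α : ℝ) (σ : M2) : M2 :=
  (fnorm (dev σ))⁻¹ • dev σ - (1 / (2 * α)) • (1 : M2)

lemma inn_eq_sum (A B : M2) :
    inn A B = A 0 0 * B 0 0 + A 1 0 * B 1 0 + (A 0 1 * B 0 1 + A 1 1 * B 1 1) := by
  simp [inn, Matrix.trace, Matrix.mul_apply, Fin.sum_univ_two]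

lemma inn_smul_add_smul_one_left (a b : ℝ) (A B : M2) :
    inn (a • A + b • (1 : M2)) B = a * inn A B + b * B.trace := by
  simp only [inn_eq_sum, Matrix.trace_fin_two]
  simp
  ring

lemma trace_dev (A : M2) : (dev A).trace = 0 := by
  simp [dev, Matrix.trace_fin_two]

lemma trace_smul_dev_add_smul_one (a b : ℝ) (A : M2) :
    (a • dev A + b • (1 : M2)).trace = 2 * b := by
  rw [Matrix.trace_add, Matrix.trace_smul, trace_dev, Matrix.trace_smul, Matrix.trace_one]
  simp
  ring

lemma dev_smul_dev_add_smul_one (a b : ℝ) (A : M2) :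
    dev (a • dev A + b • (1 : M2)) = a • dev A := by
  rw [dev, trace_smul_dev_add_smul_one, mul_div_cancel_left₀ b two_ne_zero, add_sub_cancel_right]

lemma inn_self_nonneg (A : M2) : 0 ≤ inn A A := by
  rw [inn_eq_sum]
  nlinarith [mul_self_nonneg (A 0 0), mul_self_nonneg (A 0 1), mul_self_nonneg (A 1 0),
    mul_self_nonneg (A 1 1)]

lemma fnorm_smul_of_nonneg {a : ℝ} (ha : 0 ≤ a) (A : M2) : fnorm (a • A) = a * fnorm A := by
  have h : inn (a • A) (a • A) = a ^ 2 * inn A A := by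
    simp only [inn_eq_sum, Matrix.smul_apply, smul_eq_mul]
    ring
  rw [fnorm, h, Real.sqrt_mul (sq_nonneg a), Real.sqrt_sq ha, fnorm]

lemma inn_dev_self (A : M2) : inn (dev A) A = fnorm (dev A) ^ 2 := by
  rw [fnorm, Real.sq_sqrt (inn_self_nonneg _)]
  simp [inn_eq_sum, dev, Matrix.trace_fin_two]
  ring

lemma isSymm_dev {A : M2} (hA : A.IsSymm) : (dev A).IsSymm :=
  hA.sub (Matrix.isSymm_one.smul _)

/-- The ray in direction `a • dev p + b • 1` stays in `Kset α κ` when `a |p_D| + 2 α b ≤ 0`. -/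
lemma smul_dev_add_smul_one_mem_Kset {α κ a b : ℝ} (hκ : 0 ≤ κ) (ha : 0 ≤ a) {p : M2}
    (hp : p.IsSymm) (h : a * fnorm (dev p) + 2 * α * b ≤ 0) :
    a • dev p + b • (1 : M2) ∈ Kset α κ := by
  refine ⟨((isSymm_dev hp).smul _).add (Matrix.isSymm_one.smul _), ?_⟩
  rw [dev_smul_dev_add_smul_one, fnorm_smul_of_nonneg ha, trace_smul_dev_add_smul_one]
  linarith

/-- A recession direction of `Kset α κ` with positive pairing against `p` rules out an upper
bound of the support function. -/
lemma not_bddAbove_inn_Kset {α κ a b : ℝ} (hκ : 0 ≤ κ) (ha : 0 ≤ a) {p : M2} (hp : p.IsSymm)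
    (h : a * fnorm (dev p) + 2 * α * b ≤ 0) (hpos : 0 < a * fnorm (dev p) ^ 2 + b * p.trace) :
    ¬ BddAbove {x : ℝ | ∃ σ ∈ Kset α κ, x = inn σ p} := by
  rintro ⟨M, hM⟩
  obtain ⟨n, hn⟩ := exists_nat_gt (M / (a * fnorm (dev p) ^ 2 + b * p.trace))
  rw [div_lt_iff₀ hpos] at hn
  have hn0 : (0 : ℝ) ≤ n := n.cast_nonneg
  have hmem : (n * a) • dev p + (n * b) • (1 : M2) ∈ Kset α κ :=
    smul_dev_add_smul_one_mem_Kset hκ (mul_nonneg hn0 ha) hp (by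
      linarith [mul_nonpos_of_nonneg_of_nonpos hn0 h])
  have hle := hM ⟨_, hmem, rfl⟩
  rw [inn_smul_add_smul_one_left, inn_dev_self] at hle
  linarith

/-- For `p ∈ 𝕄²ˣ²_sym` with `|p_D| > tr p / (2α)`, the set `{σ : p | σ ∈ K}`
is not bounded above, i.e. the support function of `K` at `p` is `+∞`. -/
theorem stmt_1 (α κ : ℝ) (hα : 0 < α) (hκ : 0 < κ) (p : M2) (hp : p.IsSymm)
    (hpd : p.trace / (2 * α) < fnorm (dev p)) :
    ¬ BddAbove {x : ℝ | ∃ σ ∈ Kset α κ, x = inn σ p} := by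
  rw [div_lt_iff₀ (by positivity)] at hpd
  have hnonneg : 0 ≤ fnorm (dev p) := Real.sqrt_nonneg _
  obtain h0 | h0 := hnonneg.eq_or_lt
  · rw [← h0, zero_mul] at hpd
    exact not_bddAbove_inn_Kset (a := 0) (b := -1) hκ.le le_rfl hp (by linarith) (by linarith)
  · refine not_bddAbove_inn_Kset (a := 2 * α) (b := -fnorm (dev p)) hκ.le (by positivity) hp
      (by linarith) ?_
    nlinarith [mul_pos h0 (sub_pos.2 hpd)]
end
end

section
/- For every i ∈ {1,2} and every σ ∈ ∂𝒜ᵢ ∖ {0}, there exists ρ > 0 such that T_σ(∂𝒜ᵢ) ∩ B(σ,ρ) ⊂ cl 𝒜₃, where T_σ(∂𝒜ᵢ) := {τ ∈ 𝕄²ˣ²_sym : ν(σ) : (τ − σ) = 0} is the tangent space to ∂𝒜ᵢ at σ and B(σ,ρ) is the open ball of radius ρ centered at σ. -/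
open Matrix Set
open scoped Classical

attribute [local instance] Matrix.frobeniusNormedAddCommGroup Matrix.frobeniusNormedSpace

noncomputable section

lemma inn_eq (A B : M2) :
    inn A B = A 0 0 * B 0 0 + A 0 1 * B 0 1 + A 1 0 * B 1 0 + A 1 1 * B 1 1 := by
  simp [inn, Matrix.trace, Matrix.mul_apply, Fin.sum_univ_two]
  ring

lemma fnorm_nonneg (A : M2) : 0 ≤ fnorm A := Real.sqrt_nonneg _

lemma fnorm_sq (A : M2) : fnorm A ^ 2 = inn A A := Real.sq_sqrt (inn_self_nonneg A)

/-- Cauchy–Schwarz inequality for the Frobenius inner product. -/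
lemma inn_le_fnorm_mul_fnorm (A B : M2) : inn A B ≤ fnorm A * fnorm B := by
  refine le_of_sq_le_sq ?_ (mul_nonneg (fnorm_nonneg A) (fnorm_nonneg B))
  rw [mul_pow, fnorm_sq, fnorm_sq]
  simp only [inn_eq]
  nlinarith [sq_nonneg (A 0 0 * B 0 1 - A 0 1 * B 0 0), sq_nonneg (A 0 0 * B 1 0 - A 1 0 * B 0 0),
    sq_nonneg (A 0 0 * B 1 1 - A 1 1 * B 0 0), sq_nonneg (A 0 1 * B 1 0 - A 1 0 * B 0 1),
    sq_nonneg (A 0 1 * B 1 1 - A 1 1 * B 0 1), sq_nonneg (A 1 0 * B 1 1 - A 1 1 * B 1 0)]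

lemma abs_trace_le (A : M2) : |A.trace| ≤ 2 * fnorm A := by
  refine abs_le_of_sq_le_sq ?_ (by linarith [fnorm_nonneg A])
  rw [mul_pow, fnorm_sq, inn_eq, Matrix.trace_fin_two]
  nlinarith [sq_nonneg (A 0 0 - A 1 1), sq_nonneg (A 0 0), sq_nonneg (A 1 1),
    sq_nonneg (A 0 1), sq_nonneg (A 1 0)]

lemma trace_add_smul_one (A : M2) (c : ℝ) : (A + c • (1 : M2)).trace = A.trace + 2 * c := by
  simp [Matrix.trace_fin_two]
  ring

lemma dev_add_smul_one (A : M2) (c : ℝ) : dev (A + c • (1 : M2)) = dev A := by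
  rw [dev, dev, trace_add_smul_one]
  module

lemma inn_dev_sub (A B : M2) :
    inn (dev A) (B - A) = inn (dev A) (dev B) - fnorm (dev A) ^ 2 := by
  rw [fnorm_sq]
  simp [inn_eq, dev, Matrix.trace_fin_two]
  ring

lemma inn_smul_dev_add_smul_one (a b : ℝ) (A B : M2) :
    inn (a • dev A + b • (1 : M2)) (B - A) =
      a * (inn (dev A) (dev B) - fnorm (dev A) ^ 2) + b * (B.trace - A.trace) := by
  rw [← inn_dev_sub]
  simp [inn_eq, dev, Matrix.trace_fin_two]
  ring

lemma eq_zero_of_fnorm_dev_of_trace {A : M2} (hd : fnorm (dev A) = 0) (ht : A.trace = 0) :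
    A = 0 := by
  have h := fnorm_sq (dev A)
  rw [hd, inn_eq] at h
  simp only [dev, ht, zero_div, zero_smul, sub_zero] at h
  ext i j
  fin_cases i <;> fin_cases j <;> simp <;>
    nlinarith [sq_nonneg (A 0 0), sq_nonneg (A 0 1), sq_nonneg (A 1 0), sq_nonneg (A 1 1)]

lemma continuous_trace : Continuous fun A : M2 => A.trace :=
  continuous_id.matrix_trace

lemma continuous_fnorm_dev : Continuous fun A : M2 => fnorm (dev A) := by
  unfold fnorm inn dev
  fun_prop

/-- The projection of a tangent direction onto `dev σ` does not exceed the growth of `|dev|`. -/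
lemma inv_mul_inn_dev_sub_le {σ : M2} (hσ : 0 < fnorm (dev σ)) (τ : M2) :
    (fnorm (dev σ))⁻¹ * (inn (dev σ) (dev τ) - fnorm (dev σ) ^ 2) ≤
      fnorm (dev τ) - fnorm (dev σ) := by
  rw [inv_mul_le_iff₀ hσ]
  linarith [inn_le_fnorm_mul_fnorm (dev σ) (dev τ)]

section Cones

variable {α lam mu : ℝ}

lemma le_zero_of_mem_closure_A1 {ξ : M2} (h : ξ ∈ closure (A1 α lam mu)) :
    mu * fnorm (dev ξ) + α * (lam + mu) * ξ.trace ≤ 0 := by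
  have hc : IsClosed {ξ : M2 | mu * fnorm (dev ξ) + α * (lam + mu) * ξ.trace ≤ 0} :=
    isClosed_le ((continuous_fnorm_dev.const_mul _).add (continuous_trace.const_mul _))
      continuous_const
  exact closure_minimal (fun x hx => hx.2.le) hc h

lemma le_of_mem_closure_A2 {ξ : M2} (h : ξ ∈ closure (A2 α)) :
    fnorm (dev ξ) ≤ ξ.trace / (2 * α) := by
  have hc : IsClosed {ξ : M2 | fnorm (dev ξ) ≤ ξ.trace / (2 * α)} :=
    isClosed_le continuous_fnorm_dev (continuous_trace.div_const _)
  exact closure_minimal (fun x hx => hx.2.le) hc h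

lemma isSymm_of_mem_closure {s : Set M2} (hs : s ⊆ Msym) {ξ : M2} (h : ξ ∈ closure s) :
    ξ.IsSymm := by
  have hc : IsClosed {ξ : M2 | ξᵀ = ξ} := isClosed_eq continuous_id.matrix_transpose continuous_id
  exact closure_minimal (fun x hx => hs hx) hc h

lemma mem_A3 {ξ : M2} (hs : ξ.IsSymm)
    (h1 : 0 < mu * fnorm (dev ξ) + α * (lam + mu) * ξ.trace)
    (h2 : ξ.trace / (2 * α) < fnorm (dev ξ)) : ξ ∈ A3 α lam mu := by
  refine ⟨hs, ?_⟩
  rintro (h | h)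
  · exact absurd (le_zero_of_mem_closure_A1 h) (not_le.2 h1)
  · exact absurd (le_of_mem_closure_A2 h) (not_le.2 h2)

lemma mem_closure_of_add_smul_one_mem {s : Set M2} {τ : M2} {c δ : ℝ} (hδ : 0 < δ)
    (h : ∀ ε, 0 < ε → ε < δ → τ + (c * ε) • (1 : M2) ∈ s) : τ ∈ closure s := by
  have hcont : Continuous fun ε : ℝ => τ + (c * ε) • (1 : M2) := by fun_prop
  have ht : Filter.Tendsto (fun ε : ℝ => τ + (c * ε) • (1 : M2)) (nhdsWithin 0 (Ioi 0))
      (nhds τ) := by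
    simpa using (hcont.tendsto 0).mono_left nhdsWithin_le_nhds
  refine mem_closure_of_tendsto ht ?_
  filter_upwards [Ioo_mem_nhdsGT hδ] with ε hε using h ε hε.1 hε.2

lemma mem_closure_A3_of_trace_neg (hα : 0 < α) (hlm : 0 < lam + mu) {τ : M2} (hs : τ.IsSymm)
    (h1 : 0 ≤ mu * fnorm (dev τ) + α * (lam + mu) * τ.trace) (ht : τ.trace < 0) :
    τ ∈ closure (A3 α lam mu) := by
  refine mem_closure_of_add_smul_one_mem (c := 1) (δ := -τ.trace / 2) (by linarith)
    fun ε hε hεδ => ?_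
  refine mem_A3 (hs.add (Matrix.isSymm_one.smul _)) ?_ ?_ <;>
    rw [dev_add_smul_one, trace_add_smul_one]
  · nlinarith [mul_pos (mul_pos hα hlm) hε]
  · exact (div_neg_of_neg_of_pos (by linarith) (by linarith)).trans_le (fnorm_nonneg _)

lemma mem_closure_A3_of_trace_pos (hα : 0 < α) (hmu : 0 < mu) (hlm : 0 < lam + mu) {τ : M2}
    (hs : τ.IsSymm) (h2 : τ.trace / (2 * α) ≤ fnorm (dev τ)) (ht : 0 < τ.trace) :
    τ ∈ closure (A3 α lam mu) := by
  refine mem_closure_of_add_smul_one_mem (c := -1) (δ := τ.trace / 2) (by linarith)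
    fun ε hε hεδ => ?_
  refine mem_A3 (hs.add (Matrix.isSymm_one.smul _)) ?_ ?_ <;>
    rw [dev_add_smul_one, trace_add_smul_one]
  · exact add_pos_of_nonneg_of_pos (mul_nonneg hmu.le (fnorm_nonneg _))
      (mul_pos (mul_pos hα hlm) (by linarith))
  · exact (div_lt_div_of_pos_right (by linarith) (by linarith)).trans_le h2

end Cones

/-- For `i = 1, 2` and every `σ ∈ ∂𝒜ᵢ ∖ {0}` there is `ρ > 0` such that the
tangent space `T_σ(∂𝒜ᵢ) = {τ ∈ 𝕄²ˣ²_sym : ν(σ) : (τ − σ) = 0}` intersected with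
`B(σ,ρ)` is contained in `cl 𝒜₃`. -/
theorem stmt_18 (α lam mu : ℝ) (hα : 0 < α) (hmu : 0 < mu) (hlm : 0 < lam + mu) :
    (∀ σ ∈ bdryA1 α lam mu, σ ≠ 0 → ∃ ρ : ℝ, 0 < ρ ∧
      ∀ τ : M2, τ.IsSymm → inn (nu1 α lam mu σ) (τ - σ) = 0 → fnorm (τ - σ) < ρ →
        τ ∈ closure (A3 α lam mu)) ∧
    (∀ σ ∈ bdryA2 α, σ ≠ 0 → ∃ ρ : ℝ, 0 < ρ ∧
      ∀ τ : M2, τ.IsSymm → inn (nu2 α σ) (τ - σ) = 0 → fnorm (τ - σ) < ρ →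
        τ ∈ closure (A3 α lam mu)) := by
  refine ⟨fun σ hσ hσ0 => ?_, fun σ hσ hσ0 => ?_⟩
  · have hsymm : σ.IsSymm := isSymm_of_mem_closure (fun x hx => hx.1) hσ.1
    have heq : mu * fnorm (dev σ) + α * (lam + mu) * σ.trace = 0 :=
      (le_zero_of_mem_closure_A1 hσ.1).antisymm (not_lt.1 fun h => hσ.2 ⟨hsymm, h⟩)
    have hk : 0 < α * (lam + mu) := mul_pos hα hlm
    have hd : 0 < fnorm (dev σ) := by
      refine (fnorm_nonneg _).lt_of_ne' fun h => hσ0 (eq_zero_of_fnorm_dev_of_trace h ?_)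
      rw [h, mul_zero, zero_add] at heq
      exact (mul_eq_zero.1 heq).resolve_left hk.ne'
    have ht : σ.trace < 0 := by
      by_contra! h
      linarith [mul_nonneg hk.le h, mul_pos hmu hd]
    refine ⟨-σ.trace / 2, by linarith, fun τ hτ hν hρ => ?_⟩
    have htr := (abs_le.1 (abs_trace_le (τ - σ))).2
    rw [Matrix.trace_sub] at htr
    refine mem_closure_A3_of_trace_neg hα hlm hτ ?_ (by linarith)
    rw [nu1, inn_smul_dev_add_smul_one, mul_assoc mu] at hν
    linarith [mul_le_mul_of_nonneg_left (inv_mul_inn_dev_sub_le hd τ) hmu.le]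
  · have hsymm : σ.IsSymm := isSymm_of_mem_closure (fun x hx => hx.1) hσ.1
    have heq : fnorm (dev σ) = σ.trace / (2 * α) :=
      (le_of_mem_closure_A2 hσ.1).antisymm (not_lt.1 fun h => hσ.2 ⟨hsymm, h⟩)
    have hk : 0 < 2 * α := by linarith
    have htd : σ.trace = fnorm (dev σ) * (2 * α) := by rw [heq, div_mul_cancel₀ _ hk.ne']
    have hd : 0 < fnorm (dev σ) := by
      refine (fnorm_nonneg _).lt_of_ne' fun h => hσ0 (eq_zero_of_fnorm_dev_of_trace h ?_)
      rw [htd, h, zero_mul]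
    have ht : 0 < σ.trace := htd ▸ mul_pos hd hk
    refine ⟨σ.trace / 2, by linarith, fun τ hτ hν hρ => ?_⟩
    have htr := (abs_le.1 (abs_trace_le (τ - σ))).1
    rw [Matrix.trace_sub] at htr
    refine mem_closure_A3_of_trace_pos hα hmu hlm hτ ?_ (by linarith)
    rw [nu2, sub_eq_add_neg, ← neg_smul, inn_smul_dev_add_smul_one] at hν
    have hsplit : -(1 / (2 * α)) * (τ.trace - σ.trace) =
        σ.trace / (2 * α) - τ.trace / (2 * α) := by ring
    linarith [inv_mul_inn_dev_sub_le hd τ]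
end
end
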